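/- Let E be a real inner product space, let f : E → ℝ be differentiable with L-Lipschitz gradient for some L > 0, let ψ : E → ℝ be convex, and set F := f + ψ. Let η > 0, γ ∈ (0,1], and w, v ∈ E. Suppose ŵ ∈ E is a proximal point of ψ at w − ηv with parameter η, and set w⁺ := (1−γ)w + γŵ. Then F(w⁺) ≤ F(w) + γ·⟨∇f(w) − v, ŵ − w⟩ − (γ/η − Lγ²/2)·‖ŵ − w‖². -/

import Mathlib

open RealInnerProductSpace

/-- `p` is a proximal point of `ψ` at `u` with parameter `η`, i.e. `p`
minimizes `z ↦ ψ(z) + (1/(2η))‖z − u‖²`. -/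
def IsProxPt {E : Type*} [NormedAddCommGroup E] [InnerProductSpace ℝ E]
    (ψ : E → ℝ) (η : ℝ) (u p : E) : Prop :=
  ∀ z : E, ψ p + 1 / (2 * η) * ‖p - u‖ ^ 2 ≤ ψ z + 1 / (2 * η) * ‖z - u‖ ^ 2

/-- Descent lemma for a differentiable function with `L`-Lipschitz gradient. -/
theorem descent_of_gradient_lipschitz {E : Type*} [NormedAddCommGroup E]
    [InnerProductSpace ℝ E] [CompleteSpace E] {f : E → ℝ} (hf : Differentiable ℝ f) {L : ℝ}
    (hlip : ∀ x y : E, ‖gradient f x - gradient f y‖ ≤ L * ‖x - y‖) (w d : E) {γ : ℝ}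
    (hγ : 0 ≤ γ) :
    f (w + γ • d) ≤ f w + γ * ⟪gradient f w, d⟫ + L * γ ^ 2 / 2 * ‖d‖ ^ 2 := by
  have hder (t : ℝ) : HasDerivAt
      (fun t : ℝ => f (w + t • d) - t * ⟪gradient f w, d⟫ - t ^ 2 * (L / 2 * ‖d‖ ^ 2))
      (⟪gradient f (w + t • d), d⟫ - ⟪gradient f w, d⟫ - 2 * t * (L / 2 * ‖d‖ ^ 2)) t := by
    have hline : HasDerivAt (fun t : ℝ => w + t • d) d t := by
      simpa using ((hasDerivAt_id t).smul_const d).const_add w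
    have hcomp : HasDerivAt (fun t : ℝ => f (w + t • d)) ⟪gradient f (w + t • d), d⟫ t :=
      ((hf (w + t • d)).hasGradientAt.hasFDerivAt.comp_hasDerivAt t hline :).congr_deriv
        (InnerProductSpace.toDual_apply_apply ..)
    have hlin := (hasDerivAt_id t).mul_const ⟪gradient f w, d⟫
    have hsq := (hasDerivAt_pow 2 t).mul_const (L / 2 * ‖d‖ ^ 2)
    exact ((hcomp.sub hlin).sub hsq).congr_deriv (by norm_num)
  have hanti := antitoneOn_of_deriv_nonpos (convex_Ici (0 : ℝ))
    (fun t _ => (hder t).continuousAt.continuousWithinAt)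
    (fun t _ => (hder t).differentiableAt.differentiableWithinAt) (fun t ht => by
      rw [interior_Ici] at ht
      have ht0 : 0 ≤ t := le_of_lt ht
      rw [(hder t).deriv, ← inner_sub_left]
      have hcs := real_inner_le_norm (gradient f (w + t • d) - gradient f w) d
      have hgrad := hlip (w + t • d) w
      rw [add_sub_cancel_left, norm_smul, Real.norm_of_nonneg ht0] at hgrad
      nlinarith [mul_le_mul_of_nonneg_right hgrad (norm_nonneg d)])
  have hle := hanti Set.self_mem_Ici hγ hγ
  simp only [zero_smul, add_zero] at hle
  linarith

/-- Variational inequality characterizing proximal points of a convex function. -/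
theorem IsProxPt.add_inner_le {E : Type*} [NormedAddCommGroup E] [InnerProductSpace ℝ E]
    {ψ : E → ℝ} (hψ : ConvexOn ℝ Set.univ ψ) {η : ℝ} {u p : E}
    (hp : IsProxPt ψ η u p) (z : E) :
    ψ p + 1 / η * ⟪u - p, z - p⟫ ≤ ψ z := by
  have hstep (t : ℝ) (ht0 : 0 < t) (ht1 : t ≤ 1) :
      0 ≤ ψ z - ψ p - 1 / η * ⟪u - p, z - p⟫ + t * (1 / (2 * η) * ‖z - p‖ ^ 2) := by
    have hmin := hp ((1 - t) • p + t • z)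
    have hconv := hψ.2 (Set.mem_univ p) (Set.mem_univ z) (sub_nonneg.2 ht1) ht0.le
      (sub_add_cancel 1 t)
    have hvec : (1 - t) • p + t • z - u = t • (z - p) - (u - p) := by module
    rw [hvec, norm_sub_sq_real (t • (z - p)), norm_smul, Real.norm_of_nonneg ht0.le,
      real_inner_smul_left, real_inner_comm (u - p), norm_sub_rev p u] at hmin
    simp only [smul_eq_mul] at hconv
    have hη : 1 / η = 2 * (1 / (2 * η)) := by
      rw [one_div, one_div, mul_inv]; ring
    rw [hη]
    refine nonneg_of_mul_nonneg_right ?_ ht0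
    nlinarith
  have hlim : Filter.Tendsto
      (fun t : ℝ => ψ z - ψ p - 1 / η * ⟪u - p, z - p⟫ + t * (1 / (2 * η) * ‖z - p‖ ^ 2))
      (nhdsWithin 0 (Set.Ioi 0)) (nhds (ψ z - ψ p - 1 / η * ⟪u - p, z - p⟫)) := by
    refine Filter.Tendsto.mono_left ?_ nhdsWithin_le_nhds
    refine Continuous.tendsto' (by fun_prop) _ _ (by simp)
  have hnonneg := ge_of_tendsto hlim (Filter.mem_of_superset
    (Ioc_mem_nhdsGT (zero_lt_one' ℝ)) fun t ht => hstep t ht.1 ht.2)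
  linarith

/-- One-iteration estimate for the composite objective `F = f + ψ` along the
averaged proximal-gradient step: if `∇f` is `L`-Lipschitz, `wHat` is a proximal
point of the convex `ψ` at `w − ηv`, and `w⁺ := (1−γ)w + γ·wHat`, then
`F(w⁺) ≤ F(w) + γ⟨∇f(w) − v, wHat − w⟩ − (γ/η − Lγ²/2)‖wHat − w‖²`. -/
theorem stmt_10 {E : Type*} [NormedAddCommGroup E] [InnerProductSpace ℝ E]
    [CompleteSpace E] (f : E → ℝ) (hf : Differentiable ℝ f) (L : ℝ) (hL : 0 < L)
    (hlip : ∀ x y : E, ‖gradient f x - gradient f y‖ ≤ L * ‖x - y‖)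
    (ψ : E → ℝ) (hψ : ConvexOn ℝ Set.univ ψ)
    (η γ : ℝ) (hη : 0 < η) (hγ0 : 0 < γ) (hγ1 : γ ≤ 1)
    (w v wHat : E) (hw : IsProxPt ψ η (w - η • v) wHat) :
    f ((1 - γ) • w + γ • wHat) + ψ ((1 - γ) • w + γ • wHat) ≤
      f w + ψ w + γ * ⟪gradient f w - v, wHat - w⟫ -
        (γ / η - L * γ ^ 2 / 2) * ‖wHat - w‖ ^ 2 := by
  have hdesc := descent_of_gradient_lipschitz hf hlip w (wHat - w) hγ0.le
  have hprox := hw.add_inner_le hψ w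
  have hconv := hψ.2 (Set.mem_univ w) (Set.mem_univ wHat) (sub_nonneg.2 hγ1) hγ0.le
    (sub_add_cancel 1 γ)
  have hpt : w + γ • (wHat - w) = (1 - γ) • w + γ • wHat := by module
  have hinner : 1 / η * ⟪w - η • v - wHat, w - wHat⟫ =
      ‖wHat - w‖ ^ 2 / η + ⟪v, wHat - w⟫ := by
    have hleft : w - η • v - wHat = -((wHat - w) + η • v) := by module
    rw [hleft, ← neg_sub wHat w, inner_neg_neg, inner_add_left, real_inner_smul_left,
      real_inner_self_eq_norm_sq]
    field_simp
  rw [hpt] at hdesc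
  rw [hinner] at hprox
  simp only [smul_eq_mul] at hconv
  have hscaled := mul_le_mul_of_nonneg_left hprox hγ0.le
  rw [inner_sub_left]
  have hdiv : γ / η * ‖wHat - w‖ ^ 2 = γ * (‖wHat - w‖ ^ 2 / η) := by ring
  linarith
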